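/- Define ψ(x) = (x(1−x))^{0.697}·(5 − √(x(1−x))) for 0 < x < 1. Let W be a balanced tetrahedral erasure channel with 0 < H(W) < 1 and Q(W) ≥ 9/7. Then ψ(H(W^s)) + ψ(H(W^p)) < 2·0.818·ψ(H(W)). -/

import Mathlib

noncomputable section

/-- A quintuple of reals representing a candidate tetrahedral erasure channel
`W = (p, q, r, s, t)`. -/
structure TECQuint where
  p : ℝ
  q : ℝ
  r : ℝ
  s : ℝ
  t : ℝ

namespace TECQuint

/-- `W` is a tetrahedral erasure channel: all five entries are nonnegative and sum to 1. -/
def IsTEC (W : TECQuint) : Prop :=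
  0 ≤ W.p ∧ 0 ≤ W.q ∧ 0 ≤ W.r ∧ 0 ≤ W.s ∧ 0 ≤ W.t ∧
    W.p + W.q + W.r + W.s + W.t = 1

/-- `W` is balanced: `q = r = s`. -/
def Balanced (W : TECQuint) : Prop := W.q = W.r ∧ W.r = W.s

/-- The serial child `W^s`. -/
def ser (W : TECQuint) : TECQuint where
  p := W.p ^ 2
  q := W.p * W.s + W.s * W.q + W.q * W.p
  r := W.p * W.q + W.q * W.r + W.r * W.p
  s := W.p * W.r + W.r * W.s + W.s * W.p
  t := 1 - (W.p ^ 2 + (W.p * W.s + W.s * W.q + W.q * W.p)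
      + (W.p * W.q + W.q * W.r + W.r * W.p)
      + (W.p * W.r + W.r * W.s + W.s * W.p))

/-- The parallel child `W^p`. -/
def par (W : TECQuint) : TECQuint where
  p := 1 - ((W.t * W.s + W.s * W.q + W.q * W.t)
      + (W.t * W.q + W.q * W.r + W.r * W.t)
      + (W.t * W.r + W.r * W.s + W.s * W.t) + W.t ^ 2)
  q := W.t * W.s + W.s * W.q + W.q * W.t
  r := W.t * W.q + W.q * W.r + W.r * W.t
  s := W.t * W.r + W.r * W.s + W.s * W.t
  t := W.t ^ 2

/-- The moment of inertia `A(W) = (q−r)² + (r−s)² + (s−q)²`. -/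
def inertia (W : TECQuint) : ℝ :=
  (W.q - W.r) ^ 2 + (W.r - W.s) ^ 2 + (W.s - W.q) ^ 2

/-- The (conditional) entropy `H(W) = (q+r+s)/2 + t`. -/
def entropy (W : TECQuint) : ℝ := (W.q + W.r + W.s) / 2 + W.t

/-- The edge mass `E(W) = q + r + s`. -/
def edgeMass (W : TECQuint) : ℝ := W.q + W.r + W.s

/-- The Quetelet index `Q(W) = E(W) / (H(W)(1−H(W)))`. -/
def quetelet (W : TECQuint) : ℝ :=
  edgeMass W / (entropy W * (1 - entropy W))

/-- One step of the channel process: `true` picks the serial child, `false` the parallel child. -/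
def child (W : TECQuint) (b : Bool) : TECQuint := if b then ser W else par W

/-- The descendant `W^c` of `W` along the string `c ∈ {s,p}^n`. -/
def descend : TECQuint → {n : ℕ} → (Fin n → Bool) → TECQuint
  | W, 0, _ => W
  | W, _ + 1, c => descend (child W (c 0)) (fun i => c i.succ)

end TECQuint

open TECQuint

/-- The eigenfunction `ψ(x) = (x(1−x))^0.697 · (5 − √(x(1−x)))`. -/
noncomputable def psi (x : ℝ) : ℝ :=
  (x * (1 - x)) ^ (0.697 : ℝ) * (5 - Real.sqrt (x * (1 - x)))


/-- `psi` as a function of `u = x(1-x)`. -/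
def gfun (u : ℝ) : ℝ := 5 * u ^ (0.697 : ℝ) - u ^ (1.197 : ℝ)

lemma rpow_split {u : ℝ} (hu : 0 ≤ u) : u ^ (1.197 : ℝ) = u ^ (0.697 : ℝ) * √u := by
  rw [Real.sqrt_eq_rpow, ← Real.rpow_add' hu (by norm_num)]
  norm_num

lemma psi_eq {x : ℝ} (h0 : 0 ≤ x) (h1 : x ≤ 1) : psi x = gfun (x * (1 - x)) := by
  have hu : 0 ≤ x * (1 - x) := mul_nonneg h0 (by linarith)
  unfold psi gfun
  rw [rpow_split hu]
  ring

lemma gfun_concave : ConcaveOn ℝ (Set.Ici 0) gfun := by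
  have h1 := (Real.concaveOn_rpow (p := 0.697) (by norm_num) (by norm_num)).smul
    (c := (5 : ℝ)) (by norm_num)
  have h2 := (convexOn_rpow (p := 1.197) (by norm_num))
  exact h1.sub h2

lemma gfun_mono {u₁ u₂ : ℝ} (h0 : 0 ≤ u₁) (h : u₁ ≤ u₂) (h2 : u₂ ≤ 0.64) :
    gfun u₁ ≤ gfun u₂ := by
  rcases eq_or_lt_of_le h0 with h0₁ | hpos
  · subst h0₁
    have : gfun 0 = 0 := by
      unfold gfun
      rw [Real.zero_rpow (by norm_num), Real.zero_rpow (by norm_num)]; norm_num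
    rw [this]
    unfold gfun
    rw [rpow_split h]
    have h3 : √u₂ ≤ 0.8 := by
      rw [Real.sqrt_le_left (by norm_num)]; norm_num at *; linarith
    have h4 := Real.rpow_nonneg h 0.697
    nlinarith
  have hle : gfun u₂ ≤ 4 := by
    have hu2 : 0 < u₂ := by linarith
    have h3 : √u₂ ≤ 0.8 := by
      rw [Real.sqrt_le_left (by norm_num)]; norm_num at *; linarith
    have h4 : u₂ ^ (0.697 : ℝ) ≤ √u₂ := by
      rw [Real.sqrt_eq_rpow]
      exact Real.rpow_le_rpow_of_exponent_ge hu2 (by norm_num at *; linarith) (by norm_num)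
    have h5 := Real.rpow_nonneg hu2.le 1.197
    unfold gfun
    norm_num at *
    linarith
  have hg1 : gfun 1 = 4 := by unfold gfun; norm_num
  by_contra hlt
  push Not at hlt
  have hl : 0 < 1 - u₁ := by norm_num at h2; linarith
  have hc := gfun_concave.2 (Set.mem_Ici.2 h0) (Set.mem_Ici.2 (zero_le_one' ℝ))
    (div_nonneg (by norm_num at h2; linarith) hl.le : 0 ≤ (1 - u₂) / (1 - u₁))
    (div_nonneg (by linarith) hl.le : 0 ≤ (u₂ - u₁) / (1 - u₁))
    (by field_simp; ring)
  simp only [smul_eq_mul] at hc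
  rw [hg1] at hc
  have e : (1 - u₂) / (1 - u₁) * u₁ + (u₂ - u₁) / (1 - u₁) * 1 = u₂ := by field_simp; ring
  rw [e] at hc
  have e2 : (1 - u₂) / (1 - u₁) + (u₂ - u₁) / (1 - u₁) = 1 := by field_simp; ring
  have p1 : 0 < (1 - u₂) / (1 - u₁) := div_pos (by norm_num at h2; linarith) hl
  have p2 : 0 ≤ (u₂ - u₁) / (1 - u₁) := div_nonneg (by linarith) hl.le
  nlinarith [mul_pos p1 (sub_pos.2 hlt), mul_nonneg p2 (sub_nonneg.2 hle)]

lemma psi_concave {x y a b : ℝ} (hx0 : 0 ≤ x) (hx1 : x ≤ 1) (hy0 : 0 ≤ y) (hy1 : y ≤ 1)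
    (ha : 0 ≤ a) (hb : 0 ≤ b) (hab : a + b = 1) :
    a * psi x + b * psi y ≤ psi (a * x + b * y) := by
  have hz0 : 0 ≤ a * x + b * y := by positivity
  have hz1 : a * x + b * y ≤ 1 := by nlinarith
  rw [psi_eq hx0 hx1, psi_eq hy0 hy1, psi_eq hz0 hz1]
  have hux : 0 ≤ x * (1 - x) := mul_nonneg hx0 (by linarith)
  have huy : 0 ≤ y * (1 - y) := mul_nonneg hy0 (by linarith)
  have hc := gfun_concave.2 (Set.mem_Ici.2 hux) (Set.mem_Ici.2 huy) ha hb hab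
  simp only [smul_eq_mul] at hc
  refine hc.trans (gfun_mono (by positivity) ?_ ?_)
  · have hb₁ : b = 1 - a := by linarith
    subst hb₁
    nlinarith [mul_nonneg (mul_nonneg ha hb) (sq_nonneg (x - y))]
  · norm_num
    nlinarith [sq_nonneg (a * x + b * y - 1 / 2)]

lemma psi_spread {p q p₁ q₁ : ℝ} (h0 : 0 ≤ p) (h1 : p ≤ p₁) (h2 : p₁ ≤ q₁) (h3 : q ≤ 1)
    (hs : p + q = p₁ + q₁) : psi p + psi q ≤ psi p₁ + psi q₁ := by
  rcases eq_or_lt_of_le (show p ≤ q by linarith) with he | hlt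
  · have : p₁ = p := by linarith
    have : q₁ = q := by linarith
    simp [*]
  have hd : 0 < q - p := by linarith
  have k1 := psi_concave (x := p) (y := q) (a := (q - p₁) / (q - p)) (b := (p₁ - p) / (q - p))
    h0 (by linarith) (by linarith) h3 (div_nonneg (by linarith) hd.le)
    (div_nonneg (by linarith) hd.le) (by field_simp; ring)
  have k2 := psi_concave (x := p) (y := q) (a := (p₁ - p) / (q - p)) (b := (q - p₁) / (q - p))
    h0 (by linarith) (by linarith) h3 (div_nonneg (by linarith) hd.le)
    (div_nonneg (by linarith) hd.le) (by field_simp; ring)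
  have e1 : (q - p₁) / (q - p) * p + (p₁ - p) / (q - p) * q = p₁ := by field_simp; ring
  have e2 : (p₁ - p) / (q - p) * p + (q - p₁) / (q - p) * q = q₁ := by
    have : q₁ = p + q - p₁ := by linarith
    rw [this]; field_simp; ring
  have e3 : (q - p₁) / (q - p) + (p₁ - p) / (q - p) = 1 := by field_simp; ring
  rw [e1] at k1
  rw [e2] at k2
  have e4 : (q - p₁) / (q - p) = 1 - (p₁ - p) / (q - p) := by linarith
  rw [e4] at k1 k2
  linarith

lemma bernoulli_nonpos {t α : ℝ} (ht : 0 < t) (hα : α ≤ 2) :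
    1 + (α - 2) * (t - 1) ≤ t ^ (α - 2) := by
  have h := one_add_mul_self_le_rpow_one_add (s := t⁻¹ - 1)
    (by have := inv_pos.2 ht; linarith) (p := 3 - α) (by linarith)
  rw [show 1 + (t⁻¹ - 1) = t⁻¹ by ring, Real.inv_rpow ht.le, ← Real.rpow_neg ht.le] at h
  have e : t ^ (α - 2) = t * t ^ (-(3 - α)) := by
    nth_rewrite 2 [← Real.rpow_one t]
    rw [← Real.rpow_add ht]
    congr 1
    ring
  rw [e]
  have h2 := mul_le_mul_of_nonneg_left h ht.le
  have e2 : t * (1 + (3 - α) * (t⁻¹ - 1)) = 1 + (α - 2) * (t - 1) := by field_simp; ring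
  linarith

/-- Cubic Taylor comparison for real powers with exponent at most `2`. -/
lemma taylor_cubic {α : ℝ} (hα : α ≤ 2) {t : ℝ} (ht : 0 < t) (ha : α * (α - 1) ≠ 0) :
    0 ≤ (t ^ α - (1 + α * (t - 1) + α * (α - 1) / 2 * (t - 1) ^ 2
      + α * (α - 1) * (α - 2) / 6 * (t - 1) ^ 3)) / (α * (α - 1)) := by
  set D : ℝ → ℝ := fun t => (t ^ α - (1 + α * (t - 1) + α * (α - 1) / 2 * (t - 1) ^ 2
      + α * (α - 1) * (α - 2) / 6 * (t - 1) ^ 3)) / (α * (α - 1)) with hD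
  set D1 : ℝ → ℝ := fun t => (α * t ^ (α - 1) - (α + α * (α - 1) * (t - 1)
      + α * (α - 1) * (α - 2) / 2 * (t - 1) ^ 2)) / (α * (α - 1)) with hD1
  set D2 : ℝ → ℝ := fun t => t ^ (α - 2) - 1 - (α - 2) * (t - 1) with hD2
  have hd : ∀ t : ℝ, 0 < t → HasDerivAt D (D1 t) t := by
    intro t ht
    have h1 := Real.hasDerivAt_rpow_const (x := t) (p := α) (Or.inl ht.ne')
    have h2 := (hasDerivAt_id t).sub_const 1
    have h3 := ((((h2.const_mul α).const_add 1).add ((h2.pow 2).const_mul (α * (α - 1) / 2))).add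
      ((h2.pow 3).const_mul (α * (α - 1) * (α - 2) / 6)))
    refine ((h1.sub h3).div_const (α * (α - 1))).congr_deriv ?_
    simp [hD1]
    ring
  have hd1 : ∀ t : ℝ, 0 < t → HasDerivAt D1 (D2 t) t := by
    intro t ht
    have h1 := (Real.hasDerivAt_rpow_const (x := t) (p := α - 1) (Or.inl ht.ne')).const_mul α
    have h2 := (hasDerivAt_id t).sub_const 1
    have h3 := (((h2.const_mul (α * (α - 1))).const_add α).add
      ((h2.pow 2).const_mul (α * (α - 1) * (α - 2) / 2)))
    refine ((h1.sub h3).div_const (α * (α - 1))).congr_deriv ?_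
    simp [hD2]
    rw [show α - 1 - 1 = α - 2 by ring, div_eq_iff ha]
    ring
  have hD2nn : ∀ t : ℝ, 0 < t → 0 ≤ D2 t := by
    intro t ht
    have := bernoulli_nonpos ht (α := α) hα
    simp only [hD2]
    linarith
  have hm1 : MonotoneOn D1 (Set.Ioi 0) := by
    apply monotoneOn_of_deriv_nonneg (convex_Ioi 0)
    · exact fun t ht => (hd1 t ht).continuousAt.continuousWithinAt
    · intro t ht
      rw [interior_Ioi] at ht
      exact (hd1 t ht).differentiableAt.differentiableWithinAt
    · intro t ht
      rw [interior_Ioi] at ht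
      rw [(hd1 t ht).deriv]
      exact hD2nn t ht
  have hD11 : D1 1 = 0 := by simp [hD1]
  have hD01 : D 1 = 0 := by simp [hD]
  have one : (1:ℝ) ∈ Set.Ioi (0:ℝ) := by norm_num
  change 0 ≤ D t
  rw [← hD01]
  rcases le_total 1 t with h | h
  · have : MonotoneOn D (Set.Ici 1) := by
      have pos : ∀ t ∈ Set.Ici (1:ℝ), 0 < t := fun t ht => lt_of_lt_of_le one_pos ht
      apply monotoneOn_of_deriv_nonneg (convex_Ici 1)
      · exact fun t ht => (hd t (pos t ht)).continuousAt.continuousWithinAt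
      · intro t ht
        exact (hd t (pos t (interior_subset ht))).differentiableAt.differentiableWithinAt
      · intro t ht
        have ht := interior_subset ht
        rw [(hd t (pos t ht)).deriv, ← hD11]
        exact hm1 one (pos t ht) ht
    exact this Set.self_mem_Ici h h
  · have : AntitoneOn D (Set.Ioc 0 1) := by
      apply antitoneOn_of_deriv_nonpos (convex_Ioc 0 1)
      · exact fun t ht => (hd t ht.1).continuousAt.continuousWithinAt
      · intro t ht
        exact (hd t (interior_subset ht).1).differentiableAt.differentiableWithinAt
      · intro t ht
        have ht := interior_subset ht
        rw [(hd t ht.1).deriv, ← hD11]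
        exact hm1 ht.1 one ht.2
    exact this ⟨ht, h⟩ ⟨one, le_refl _⟩ h

/-- Cubic upper Taylor polynomial of `(1+τ)^0.697`. -/
def Tup (τ : ℝ) : ℝ := 1 + 0.697 * τ - 0.1055955 * τ ^ 2 + 0.0458636455 * τ ^ 3

/-- Cubic lower Taylor polynomial of `(1+τ)^1.197`. -/
def Tlo (τ : ℝ) : ℝ := 1 + 1.197 * τ + 0.1179045 * τ ^ 2 - 0.0315591045 * τ ^ 3

lemma le_Tup {τ : ℝ} (h : -1 < τ) : (1 + τ) ^ (0.697 : ℝ) ≤ Tup τ := by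
  have h1 := taylor_cubic (α := 0.697) (by norm_num) (show 0 < 1 + τ by linarith) (by norm_num)
  rw [le_div_iff_of_neg (by norm_num)] at h1
  unfold Tup
  norm_num at *
  linarith

lemma Tlo_le {τ : ℝ} (h : -1 < τ) : Tlo τ ≤ (1 + τ) ^ (1.197 : ℝ) := by
  have h1 := taylor_cubic (α := 1.197) (by norm_num) (show 0 < 1 + τ by linarith) (by norm_num)
  rw [le_div_iff₀ (by norm_num)] at h1
  unfold Tlo
  norm_num at *
  linarith

lemma rpow_le_of_pow {a K : ℝ} (ha : 0 ≤ a) (hK : 0 ≤ K) (h : a ^ 697 ≤ K ^ 1000) :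
    a ^ (0.697 : ℝ) ≤ K := by
  have e : a ^ (0.697 : ℝ) = (a ^ 697) ^ ((1000 : ℕ) : ℝ)⁻¹ := by
    rw [← Real.rpow_natCast, ← Real.rpow_mul ha]; norm_num
  rw [e, ← Real.pow_rpow_inv_natCast hK (n := 1000) (by norm_num)]
  exact Real.rpow_le_rpow (pow_nonneg ha _) h (inv_nonneg.2 (Nat.cast_nonneg _))

lemma le_rpow_of_pow {a K : ℝ} (ha : 0 ≤ a) (hK : 0 ≤ K) (h : K ^ 1000 ≤ a ^ 1197) :
    K ≤ a ^ (1.197 : ℝ) := by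
  have e : a ^ (1.197 : ℝ) = (a ^ 1197) ^ ((1000 : ℕ) : ℝ)⁻¹ := by
    rw [← Real.rpow_natCast, ← Real.rpow_mul ha]; norm_num
  rw [e, ← Real.pow_rpow_inv_natCast hK (n := 1000) (by norm_num)]
  exact Real.rpow_le_rpow (pow_nonneg hK _) h (inv_nonneg.2 (Nat.cast_nonneg _))

lemma gfun_scale {v A : ℝ} (hv : 0 ≤ v) (hA : 0 ≤ A) :
    gfun (v ^ 2 * A) = (v ^ 2) ^ (0.697 : ℝ) * (5 * A ^ (0.697 : ℝ) - v * A ^ (1.197 : ℝ)) := by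
  unfold gfun
  rw [Real.mul_rpow (by positivity) hA, Real.mul_rpow (by positivity) hA,
    rpow_split (sq_nonneg v), Real.sqrt_sq hv]
  ring

lemma term_bound {v A A0 τ K L : ℝ} (hv : 0 ≤ v) (hv2 : v ≤ 1 / 2) (hA0 : 0 < A0) (hA : 0 < A)
    (hAτ : A ≤ A0 * (1 + τ)) (hτ2 : A0 * (1 + τ) ≤ 2) (hK0 : 0 ≤ K) (hL0 : 0 ≤ L)
    (hK : A0 ^ 697 ≤ K ^ 1000) (hL : L ^ 1000 ≤ A0 ^ 1197) :
    gfun (v ^ 2 * A) ≤ (v ^ 2) ^ (0.697 : ℝ) * (5 * (K * Tup τ) - v * (L * Tlo τ)) := by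
  have hτ : -1 < τ := by
    have : 0 < A0 * (1 + τ) := by linarith
    have := (mul_pos_iff_of_pos_left hA0).1 this
    linarith
  have hv4 : v ^ 2 ≤ 1 / 4 := by nlinarith
  have h1 : gfun (v ^ 2 * A) ≤ gfun (v ^ 2 * (A0 * (1 + τ))) := by
    apply gfun_mono (by positivity) (by gcongr)
    have : v ^ 2 * (A0 * (1 + τ)) ≤ 1 / 4 * 2 := by gcongr; linarith
    norm_num at *
    linarith
  refine h1.trans ?_
  rw [gfun_scale hv (by linarith)]
  refine mul_le_mul_of_nonneg_left ?_ (by positivity)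
  have p0 : 0 ≤ 1 + τ := by linarith
  rw [Real.mul_rpow hA0.le p0, Real.mul_rpow hA0.le p0]
  have a1 := rpow_le_of_pow hA0.le hK0 hK
  have a2 := le_rpow_of_pow hA0.le hL0 hL
  have b1 : A0 ^ (0.697 : ℝ) * (1 + τ) ^ (0.697 : ℝ) ≤ K * Tup τ :=
    mul_le_mul a1 (le_Tup hτ) (by positivity) hK0
  have b2 : L * Tlo τ ≤ A0 ^ (1.197 : ℝ) * (1 + τ) ^ (1.197 : ℝ) :=
    (mul_le_mul_of_nonneg_left (Tlo_le hτ) hL0).trans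
      (mul_le_mul_of_nonneg_right a2 (by positivity))
  have := mul_le_mul_of_nonneg_left b2 hv
  linarith

/-- `z(1-z) = x(1-x)·Apoly x` for `z = x² - 0.1377 (x(1-x))²`. -/
def Apoly (x : ℝ) : ℝ := x * (1 - 0.1377 * (1 - x) ^ 2) * (1 + x + 0.1377 * (x ^ 2 * (1 - x)))

lemma Apoly_pos {x : ℝ} (h0 : 0 < x) (h1 : x < 1) : 0 < Apoly x := by
  unfold Apoly
  have : 0 < 1 - x := by linarith
  have : 0 < 1 - 0.1377 * (1 - x) ^ 2 := by norm_num; nlinarith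
  positivity

/-- The target one-variable inequality. -/
def Good (x : ℝ) : Prop :=
  gfun (x * (1 - x) * Apoly x) + gfun (x * (1 - x) * Apoly (1 - x)) < 1.636 * gfun (x * (1 - x))

lemma good_of {x v E : ℝ} (h0 : 0 < x) (h1 : x < 1) (hv : 0 ≤ v) (hv2 : v ^ 2 = x * (1 - x))
    (h : gfun (v ^ 2 * Apoly x) + gfun (v ^ 2 * Apoly (1 - x)) ≤ (v ^ 2) ^ (0.697 : ℝ) * E)
    (hE : E < 1.636 * (5 - v)) : Good x := by
  have hw : 0 < v ^ 2 := by rw [hv2]; exact mul_pos h0 (by linarith)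
  unfold Good
  rw [← hv2]
  refine h.trans_lt ?_
  have e : gfun (v ^ 2) = (v ^ 2) ^ (0.697 : ℝ) * (5 - v) := by
    have := gfun_scale hv zero_le_one
    simpa using this
  rw [e]
  have := mul_lt_mul_of_pos_left hE (Real.rpow_pos_of_pos hw 0.697)
  linarith

lemma exists_v {x : ℝ} (h0 : 0 < x) (h1 : x < 1) :
    ∃ v : ℝ, 0 ≤ v ∧ v ≤ 1 / 2 ∧ v ^ 2 = x * (1 - x) := by
  have hw : 0 < x * (1 - x) := mul_pos h0 (by linarith)
  refine ⟨√(x * (1 - x)), Real.sqrt_nonneg _, ?_, Real.sq_sqrt hw.le⟩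
  rw [Real.sqrt_le_left (by norm_num)]
  nlinarith [sq_nonneg (x - 1 / 2)]

lemma interval_step {x A0 a KA LA B0 b KB LB V : ℝ} (h0 : 0 < x) (h1 : x < 1)
    (hA0 : 0 < A0) (hB0 : 0 < B0) (hKA0 : 0 ≤ KA) (hLA0 : 0 ≤ LA) (hKB0 : 0 ≤ KB) (hLB0 : 0 ≤ LB)
    (hKA : A0 ^ 697 ≤ KA ^ 1000) (hLA : LA ^ 1000 ≤ A0 ^ 1197)
    (hKB : B0 ^ 697 ≤ KB ^ 1000) (hLB : LB ^ 1000 ≤ B0 ^ 1197)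
    (hA : 0 ≤ A0 * (1 + a) - Apoly x) (hA2 : 0 ≤ 2 - A0 * (1 + a))
    (hB : 0 ≤ B0 * (1 + b) - Apoly (1 - x)) (hB2 : 0 ≤ 2 - B0 * (1 + b))
    (hV0 : 0 ≤ V)
    (hV : (0 ≤ x * (1 - x) - V ^ 2 ∧ 0 ≤ LA * Tlo a + LB * Tlo b - 1.636) ∨
      (0 ≤ V ^ 2 - x * (1 - x) ∧ 0 ≤ 1.636 - (LA * Tlo a + LB * Tlo b)))
    (hF : 0 < 8.18 - 5 * (KA * Tup a) - 5 * (KB * Tup b)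
      + V * (LA * Tlo a + LB * Tlo b - 1.636)) : Good x := by
  obtain ⟨v, hv, hv12, hv2⟩ := exists_v h0 h1
  have tA := term_bound (τ := a) hv hv12 hA0 (Apoly_pos h0 h1) (by linarith) (by linarith) hKA0 hLA0 hKA hLA
  have tB := term_bound (τ := b) hv hv12 hB0 (Apoly_pos (sub_pos.2 h1) (by linarith)) (by linarith)
    (by linarith) hKB0 hLB0 hKB hLB
  refine good_of h0 h1 hv hv2 ((add_le_add tA tB).trans_eq (mul_add _ _ _).symm) ?_
  have key : V * (LA * Tlo a + LB * Tlo b - 1.636) ≤ v * (LA * Tlo a + LB * Tlo b - 1.636) := by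
    rcases hV with ⟨k1, k2⟩ | ⟨k1, k2⟩
    · have : V ≤ v := abs_le_of_sq_le_sq' (by linarith) hv |>.2
      exact mul_le_mul_of_nonneg_right this k2
    · have : v ≤ V := abs_le_of_sq_le_sq' (by linarith) hV0 |>.2
      exact mul_le_mul_of_nonpos_right this (by linarith)
  norm_num at hF key ⊢
  linarith

lemma exists_s {x a b : ℝ} (ha : a ≤ x) (hb : x < b) :
    ∃ s : ℝ, 0 ≤ s ∧ x = a + (b - a) * (s / (1 + s)) := by
  refine ⟨(x - a) / (b - x), div_nonneg (by linarith) (by linarith), ?_⟩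
  have : b - x ≠ 0 := by linarith
  have : b - a ≠ 0 := by linarith
  have e : 1 + (x - a) / (b - x) = (b - a) / (b - x) := by field_simp; ring
  rw [e]
  field_simp
  ring

set_option exponentiation.threshold 2000 in
lemma good_1 {x : ℝ} (ha : 0.02 ≤ x) (hb : x < 0.053) : Good x := by
  obtain ⟨s, hs, hx⟩ := exists_s ha hb
  have hs1 : 0 < 1 + s := by linarith
  refine interval_step (A0 := 0.033) (a := 0.00007 + 28.67817 * (x - 0.0365) + 35.2715 * (x - 0.0365) ^ 2)
    (KA := 0.09277) (LA := 0.01685) (B0 := 1.896)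
    (b := 0 + (-1.4959) * (x - 0.0365) + 0.20995 * (x - 0.0365) ^ 2)
    (KB := 1.56191) (LB := 2.15066)
    (V := 0.18623 + 2.52633 * (x - 0.0365) + (-19.89855) * (x - 0.0365) ^ 2)
    (by norm_num at *; linarith) (by norm_num at *; linarith)
    (by norm_num) (by norm_num) (by norm_num) (by norm_num) (by norm_num) (by norm_num)
    (by norm_num) (by norm_num) (by norm_num) (by norm_num) ?_ ?_ ?_ ?_ ?_ (Or.inl ⟨?_, ?_⟩) ?_
  all_goals
    rw [hx]
    try simp only [Apoly, Tup, Tlo]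
    field_simp
    ring_nf
    positivity

set_option exponentiation.threshold 2000 in
lemma good_2 {x : ℝ} (ha : 0.053 ≤ x) (hb : x < 0.095) : Good x := by
  obtain ⟨s, hs, hx⟩ := exists_s ha hb
  have hs1 : 0 < 1 + s := by linarith
  refine interval_step (A0 := 0.07) (a := 0.00198 + 14.77989 * (x - 0.074) + 16.95927 * (x - 0.074) ^ 2)
    (KA := 0.15669) (LA := 0.04145) (B0 := 1.79)
    (b := 0.00013 + (-1.56595) * (x - 0.074) + 0.26996 * (x - 0.074) ^ 2)
    (KB := 1.50051) (LB := 2.00754)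
    (V := 0.26138 + 1.64209 * (x - 0.074) + (-7.09227) * (x - 0.074) ^ 2)
    (by norm_num at *; linarith) (by norm_num at *; linarith)
    (by norm_num) (by norm_num) (by norm_num) (by norm_num) (by norm_num) (by norm_num)
    (by norm_num) (by norm_num) (by norm_num) (by norm_num) ?_ ?_ ?_ ?_ ?_ (Or.inl ⟨?_, ?_⟩) ?_
  all_goals
    rw [hx]
    try simp only [Apoly, Tup, Tlo]
    field_simp
    ring_nf
    positivity

set_option exponentiation.threshold 2000 in
lemma good_3 {x : ℝ} (ha : 0.095 ≤ x) (hb : x < 0.18) : Good x := by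
  obtain ⟨s, hs, hx⟩ := exists_s ha hb
  have hs1 : 0 < 1 + s := by linarith
  refine interval_step (A0 := 0.141) (a := (-0.00236) + 8.42209 * (x - 0.1375) + 8.63102 * (x - 0.1375) ^ 2)
    (KA := 0.25528) (LA := 0.09585) (B0 := 1.614)
    (b := 0.00023 + (-1.69288) * (x - 0.1375) + 0.38289 * (x - 0.1375) ^ 2)
    (KB := 1.39608) (LB := 1.77361)
    (V := 0.34367 + 1.06571 * (x - 0.1375) + (-3.12005) * (x - 0.1375) ^ 2)
    (by norm_num at *; linarith) (by norm_num at *; linarith)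
    (by norm_num) (by norm_num) (by norm_num) (by norm_num) (by norm_num) (by norm_num)
    (by norm_num) (by norm_num) (by norm_num) (by norm_num) ?_ ?_ ?_ ?_ ?_ (Or.inl ⟨?_, ?_⟩) ?_
  all_goals
    rw [hx]
    try simp only [Apoly, Tup, Tlo]
    field_simp
    ring_nf
    positivity

set_option exponentiation.threshold 2000 in
lemma good_4 {x : ℝ} (ha : 0.18 ≤ x) (hb : x < 0.2375) : Good x := by
  obtain ⟨s, hs, hx⟩ := exists_s ha hb
  have hs1 : 0 < 1 + s := by linarith
  refine interval_step (A0 := 0.231) (a := 0.00209 + 5.89784 * (x - 0.20875) + 5.35222 * (x - 0.20875) ^ 2)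
    (KA := 0.36012) (LA := 0.17307) (B0 := 1.423)
    (b := 0 + (-1.85157) * (x - 0.20875) + 0.53064 * (x - 0.20875) ^ 2)
    (KB := 1.27875) (LB := 1.5254)
    (V := 0.40634 + 0.71868 * (x - 0.20875) + (-1.86836) * (x - 0.20875) ^ 2)
    (by norm_num at *; linarith) (by norm_num at *; linarith)
    (by norm_num) (by norm_num) (by norm_num) (by norm_num) (by norm_num) (by norm_num)
    (by norm_num) (by norm_num) (by norm_num) (by norm_num) ?_ ?_ ?_ ?_ ?_ (Or.inl ⟨?_, ?_⟩) ?_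
  all_goals
    rw [hx]
    try simp only [Apoly, Tup, Tlo]
    field_simp
    ring_nf
    positivity

set_option exponentiation.threshold 2000 in
lemma good_5 {x : ℝ} (ha : 0.2375 ≤ x) (hb : x < 0.33) : Good x := by
  obtain ⟨s, hs, hx⟩ := exists_s ha hb
  have hs1 : 0 < 1 + s := by linarith
  refine interval_step (A0 := 0.341) (a := (-0.00108) + 4.54028 * (x - 0.28375) + 3.63295 * (x - 0.28375) ^ 2)
    (KA := 0.47243) (LA := 0.26587) (B0 := 1.23)
    (b := (-0.00011) + (-2.04171) * (x - 0.28375) + 0.71667 * (x - 0.28375) ^ 2)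
    (KB := 1.15522) (LB := 1.28119)
    (V := 0.45098 + 0.48203 * (x - 0.28375) + (-1.37014) * (x - 0.28375) ^ 2)
    (by norm_num at *; linarith) (by norm_num at *; linarith)
    (by norm_num) (by norm_num) (by norm_num) (by norm_num) (by norm_num) (by norm_num)
    (by norm_num) (by norm_num) (by norm_num) (by norm_num) ?_ ?_ ?_ ?_ ?_ (Or.inr ⟨?_, ?_⟩) ?_
  all_goals
    rw [hx]
    try simp only [Apoly, Tup, Tlo]
    field_simp
    ring_nf
    positivity

set_option exponentiation.threshold 2000 in
lemma good_6 {x : ℝ} (ha : 0.33 ≤ x) (hb : x < 0.41) : Good x := by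
  obtain ⟨s, hs, hx⟩ := exists_s ha hb
  have hs1 : 0 < 1 + s := by linarith
  refine interval_step (A0 := 0.483) (a := 0.00074 + 3.64503 * (x - 0.37) + 2.52388 * (x - 0.37) ^ 2)
    (KA := 0.60216) (LA := 0.41848) (B0 := 1.02)
    (b := 0.00006 + (-2.30251) * (x - 0.37) + 0.98453 * (x - 0.37) ^ 2)
    (KB := 1.0139) (LB := 1.02398)
    (V := 0.48285 + 0.27001 * (x - 0.37) + (-1.11265) * (x - 0.37) ^ 2)
    (by norm_num at *; linarith) (by norm_num at *; linarith)
    (by norm_num) (by norm_num) (by norm_num) (by norm_num) (by norm_num) (by norm_num)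
    (by norm_num) (by norm_num) (by norm_num) (by norm_num) ?_ ?_ ?_ ?_ ?_ (Or.inr ⟨?_, ?_⟩) ?_
  all_goals
    rw [hx]
    try simp only [Apoly, Tup, Tlo]
    field_simp
    ring_nf
    positivity

set_option exponentiation.threshold 2000 in
lemma good_7 {x : ℝ} (ha : 0.41 ≤ x) (hb : x < 0.501) : Good x := by
  obtain ⟨s, hs, hx⟩ := exists_s ha hb
  have hs1 : 0 < 1 + s := by linarith
  refine interval_step (A0 := 0.643) (a := (-0.00043) + 3.0566 * (x - 0.4555) + 1.82602 * (x - 0.4555) ^ 2)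
    (KA := 0.73507) (LA := 0.58942) (B0 := 0.827)
    (b := (-0.00023) + (-2.62174) * (x - 0.4555) + 1.33084 * (x - 0.4555) ^ 2)
    (KB := 0.876) (LB := 0.79662)
    (V := 0.49804 + 0.08964 * (x - 0.4555) + (-1.01365) * (x - 0.4555) ^ 2)
    (by norm_num at *; linarith) (by norm_num at *; linarith)
    (by norm_num) (by norm_num) (by norm_num) (by norm_num) (by norm_num) (by norm_num)
    (by norm_num) (by norm_num) (by norm_num) (by norm_num) ?_ ?_ ?_ ?_ ?_ (Or.inr ⟨?_, ?_⟩) ?_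
  all_goals
    rw [hx]
    try simp only [Apoly, Tup, Tlo]
    field_simp
    ring_nf
    positivity

lemma young_small {t : ℝ} (ht : 0 < t) :
    (t ^ 2) ^ (0.697 : ℝ) ≤ 0.606 * t + 0.394 * t ^ 2 := by
  have h := rpow_one_add_le_one_add_mul_self (s := t - 1) (by linarith) (p := 0.394)
    (by norm_num) (by norm_num)
  rw [show 1 + (t - 1) = t by ring] at h
  have e : (t ^ 2) ^ (0.697 : ℝ) = t * t ^ (0.394 : ℝ) := by
    rw [← Real.rpow_natCast, ← Real.rpow_mul ht.le]
    nth_rewrite 2 [← Real.rpow_one t]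
    rw [← Real.rpow_add ht]
    norm_num
  rw [e]
  have := mul_le_mul_of_nonneg_left h ht.le
  norm_num at *
  linarith

set_option exponentiation.threshold 2000 in
lemma good_0 {x : ℝ} (h0 : 0 < x) (hb : x < 0.02) : Good x := by
  have h1 : x < 1 := by norm_num at hb; linarith
  have hb₁ : x ≤ 1 / 50 := by norm_num at hb; linarith
  obtain ⟨v, hv, hv12, hv2⟩ := exists_v h0 h1
  have hvpos : 0 < v := by
    rcases eq_or_lt_of_le hv with h | h
    · rw [← h] at hv2
      have : 0 < x * (1 - x) := mul_pos h0 (by linarith)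
      norm_num at hv2
      exfalso
      rcases hv2 with h | h <;> linarith
    · exact h
  have hv14 : v ≤ 0.14 := by
    apply abs_le_of_sq_le_sq' _ (by norm_num) |>.2
    norm_num; nlinarith
  have tB := term_bound (v := v) (A := Apoly (1 - x)) (A0 := 2) (τ := -1.427 * x) (K := 1.62114)
    (L := 2.2926) hv hv12 (by norm_num) (Apoly_pos (sub_pos.2 h1) (by linarith))
    (by
      rw [← sub_nonneg]
      obtain ⟨s, hs, hx⟩ := exists_s h0.le hb
      have hs1 : 0 < 1 + s := by linarith
      rw [hx]
      simp only [Apoly]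
      field_simp
      ring_nf
      positivity)
    (by norm_num; linarith) (by norm_num) (by norm_num) (by norm_num) (by norm_num)
  have hA : Apoly x ≤ 0.0196 * (0.954 / 0.14 * v) ^ 2 := by
    rw [mul_pow, hv2, ← sub_nonneg]
    obtain ⟨s, hs, hx⟩ := exists_s h0.le hb
    have hs1 : 0 < 1 + s := by linarith
    rw [hx]
    simp only [Apoly]
    field_simp
    ring_nf
    positivity
  have tA : gfun (v ^ 2 * Apoly x) ≤ (v ^ 2) ^ (0.697 : ℝ) *
      (5 * (0.06456 * (0.606 * (0.954 / 0.14 * v) + 0.394 * (0.954 / 0.14 * v) ^ 2))) := by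
    have m : gfun (v ^ 2 * Apoly x) ≤ gfun (v ^ 2 * (0.0196 * (0.954 / 0.14 * v) ^ 2)) := by
      have := (Apoly_pos h0 h1).le
      apply gfun_mono (by positivity) (by gcongr)
      have : v ^ 2 ≤ 1 / 4 := by nlinarith
      norm_num
      nlinarith [sq_nonneg v]
    refine m.trans ?_
    rw [gfun_scale hv (by positivity)]
    refine mul_le_mul_of_nonneg_left ?_ (by positivity)
    have ht : 0 < 0.954 / 0.14 * v := by positivity
    have n1 : 0 ≤ v * (0.0196 * (0.954 / 0.14 * v) ^ 2) ^ (1.197 : ℝ) := by positivity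
    have n2 := rpow_le_of_pow (a := 0.0196) (K := 0.06456) (by norm_num) (by norm_num)
      (by norm_num)
    have n3 := young_small ht
    have n4 := mul_le_mul n2 n3 (by positivity) (by norm_num)
    rw [← Real.mul_rpow (by norm_num) (by positivity)] at n4
    linarith
  refine good_of h0 h1 hv hv2 ((add_le_add tA tB).trans_eq (mul_add _ _ _).symm) ?_
  have hx2 : v ^ 2 ≤ x := by nlinarith
  have u1 : Tup (-1.427 * x) ≤ 1 + 0.697 * (-1.427 * x) := by
    unfold Tup
    have : 0 ≤ x ^ 3 := by positivity
    have : 0 ≤ x ^ 2 := by positivity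
    norm_num
    nlinarith
  have u2 : 1 + 1.197 * (-1.427 * x) ≤ Tlo (-1.427 * x) := by
    unfold Tlo
    have : 0 ≤ x ^ 3 := by positivity
    have : 0 ≤ x ^ 2 := by positivity
    norm_num
    nlinarith
  have u3 := mul_le_mul_of_nonneg_left u2 hv
  have u4 : v * x ≤ v * (1 / 50) := by gcongr
  norm_num at *
  nlinarith [sq_nonneg (v - 7 / 50)]

lemma good_half {x : ℝ} (h0 : 0 < x) (h1 : x ≤ 1 / 2) : Good x := by
  rcases lt_or_ge x 0.02 with h | a0
  · exact good_0 h0 h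
  rcases lt_or_ge x 0.053 with h | a1
  · exact good_1 a0 h
  rcases lt_or_ge x 0.095 with h | a2
  · exact good_2 a1 h
  rcases lt_or_ge x 0.18 with h | a3
  · exact good_3 a2 h
  rcases lt_or_ge x 0.2375 with h | a4
  · exact good_4 a3 h
  rcases lt_or_ge x 0.33 with h | a5
  · exact good_5 a4 h
  rcases lt_or_ge x 0.41 with h | a6
  · exact good_6 a5 h
  exact good_7 a6 (by norm_num; linarith)

lemma good_all {x : ℝ} (h0 : 0 < x) (h1 : x < 1) : Good x := by
  rcases le_total x (1 / 2) with h | h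
  · exact good_half h0 h
  · have := good_half (x := 1 - x) (by linarith) (by linarith)
    unfold Good at *
    rw [show 1 - (1 - x) = x by ring, mul_comm (1 - x) x] at this
    linarith

theorem eigenvalue_bound (W : TECQuint) (hW : W.IsTEC) (hbal : W.Balanced)
    (h0 : 0 < entropy W) (h1 : entropy W < 1)
    (hQ : 9 / 7 ≤ quetelet W) :
    psi (entropy (ser W)) + psi (entropy (par W)) < 2 * 0.818 * psi (entropy W) := by
  obtain ⟨p, q, r, s, t⟩ := W
  obtain ⟨hp, hq, -, -, ht, hsum⟩ := hW
  obtain ⟨hqr, hrs⟩ := hbal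
  dsimp only at hp hq ht hsum hqr hrs
  subst hqr
  subst hrs
  set x := entropy ⟨p, q, q, q, t⟩ with hx
  have hxd : x = (q + q + q) / 2 + t := rfl
  have hpd : p = 1 - x - 3 / 2 * q := by rw [hxd]; linarith
  have htd : t = x - 3 / 2 * q := by rw [hxd]; ring
  have hw : 0 < x * (1 - x) := mul_pos h0 (by linarith)
  have hq3 : 9 / 7 * (x * (1 - x)) ≤ 3 * q := by
    have : quetelet ⟨p, q, q, q, t⟩ = (3 * q) / (x * (1 - x)) := by
      unfold quetelet edgeMass
      rw [← hx]
      ring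
    rw [this, le_div_iff₀ hw] at hQ
    exact hQ
  have e1 : entropy (ser ⟨p, q, q, q, t⟩) = 2 * x - x ^ 2 + 3 / 4 * q ^ 2 := by
    unfold entropy ser
    simp only
    rw [hpd]
    ring
  have e2 : entropy (par ⟨p, q, q, q, t⟩) = x ^ 2 - 3 / 4 * q ^ 2 := by
    unfold entropy par
    simp only
    rw [htd]
    ring
  have hd : 0.1377 * (x * (1 - x)) ^ 2 ≤ 3 / 4 * q ^ 2 := by
    have : 3 / 7 * (x * (1 - x)) ≤ q := by linarith
    have : (3 / 7 * (x * (1 - x))) ^ 2 ≤ q ^ 2 := by gcongr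
    norm_num
    nlinarith [sq_nonneg (x * (1 - x))]
  have hqx : (3 / 2 * q) ^ 2 ≤ x ^ 2 := by gcongr; linarith
  have hqy : (3 / 2 * q) ^ 2 ≤ (1 - x) ^ 2 := by gcongr; linarith
  have hg := good_all h0 h1
  have hz : x ^ 2 ≤ x := by nlinarith
  have hsp := psi_spread (p := x ^ 2 - 3 / 4 * q ^ 2) (q := 2 * x - x ^ 2 + 3 / 4 * q ^ 2)
    (p₁ := x ^ 2 - 0.1377 * (x * (1 - x)) ^ 2) (q₁ := 2 * x - x ^ 2 + 0.1377 * (x * (1 - x)) ^ 2)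
    (by nlinarith [sq_nonneg q]) (by linarith) (by nlinarith [sq_nonneg (x * (1 - x))])
    (by nlinarith [sq_nonneg q]) (by ring)
  have n1 : 0 ≤ x ^ 2 - 0.1377 * (x * (1 - x)) ^ 2 := by nlinarith [sq_nonneg q]
  have n2 : x ^ 2 - 0.1377 * (x * (1 - x)) ^ 2 ≤ 1 := by
    have : 0 ≤ 0.1377 * (x * (1 - x)) ^ 2 := by positivity
    linarith
  have n3 : 0 ≤ 2 * x - x ^ 2 + 0.1377 * (x * (1 - x)) ^ 2 := by
    have : 0 ≤ 0.1377 * (x * (1 - x)) ^ 2 := by positivity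
    linarith
  have n4 : 2 * x - x ^ 2 + 0.1377 * (x * (1 - x)) ^ 2 ≤ 1 := by nlinarith [sq_nonneg q]
  rw [psi_eq n1 n2, psi_eq n3 n4] at hsp
  rw [e1, e2, psi_eq h0.le h1.le]
  unfold Good at hg
  have f1 : (x ^ 2 - 0.1377 * (x * (1 - x)) ^ 2) * (1 - (x ^ 2 - 0.1377 * (x * (1 - x)) ^ 2))
      = x * (1 - x) * Apoly x := by unfold Apoly; ring
  have f2 : (2 * x - x ^ 2 + 0.1377 * (x * (1 - x)) ^ 2)
      * (1 - (2 * x - x ^ 2 + 0.1377 * (x * (1 - x)) ^ 2))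
      = x * (1 - x) * Apoly (1 - x) := by unfold Apoly; ring
  rw [f1, f2] at hsp
  norm_num at hg ⊢
  linarith
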